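/- arXiv:math/0610782 — 11 statements merged into one kernel-verified Lean document; each statement's English description precedes it below -/
import Mathlib

section
/- The kernel of K_α is J-invariant: if K_α u = 0 then K_α (J u) = 0. In particular, the real dimension of ker K_α is even. -/
open RealInnerProductSpace

/-- A real vector space carrying a complex structure has even dimension. -/
theorem even_finrank_of_sq_eq_neg {W : Type*} [AddCommGroup W] [Module ℝ W]
    (J : W →ₗ[ℝ] W) (hJ : ∀ w, J (J w) = -w) : Even (Module.finrank ℝ W) := by
  by_contra hodd
  have hsq : J ∘ₗ J = (-1 : ℝ) • LinearMap.id := by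
    ext w
    simp [hJ]
  have hdet := congrArg LinearMap.det hsq
  rw [LinearMap.det_comp, LinearMap.det_smul, LinearMap.det_id,
    (Nat.not_even_iff_odd.mp hodd).neg_one_pow] at hdet
  linarith [mul_self_nonneg (LinearMap.det J)]

/-- The kernel of `K_α` is `J`-invariant: if `K_α u = 0` then
`K_α (J u) = 0`.  In particular, the real dimension of `ker K_α` is even. -/
theorem ker_Kalpha_J_invariant_and_even_dim
    {V : Type*} [NormedAddCommGroup V] [InnerProductSpace ℝ V] [FiniteDimensional ℝ V]
    (J : V →ₗ[ℝ] V)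
    (hJ2 : ∀ v : V, J (J v) = -v)
    (hJorth : ∀ u v : V, ⟪J u, J v⟫ = ⟪u, v⟫)
    (α : V →ₗ[ℝ] V →ₗ[ℝ] ℝ)
    (halt : ∀ u : V, α u u = 0)
    (hanti : ∀ u v : V, α (J u) (J v) = -α u v)
    (K : V →ₗ[ℝ] V)
    (hK : ∀ u v : V, ⟪u, K v⟫ = α u v) :
    (∀ u : V, K u = 0 → K (J u) = 0) ∧
      Even (Module.finrank ℝ (LinearMap.ker K)) := by
  have hinv : ∀ u : V, K u = 0 → K (J u) = 0 := by
    intro u hu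
    refine ext_inner_left ℝ fun v => ?_
    have h := hanti (J v) u
    rw [hJ2, map_neg, LinearMap.neg_apply, neg_inj, ← hK, ← hK, hu] at h
    simpa using h
  refine ⟨hinv, even_finrank_of_sq_eq_neg
    (J.restrict (p := LinearMap.ker K) (q := LinearMap.ker K) hinv) fun w => ?_⟩
  exact Subtype.ext (hJ2 w)
end

section
/- The rank of K_α (the dimension of its range) is divisible by 4. -/
open RealInnerProductSpace

/-- A space carrying a nondegenerate alternating form has even dimension. -/
theorem LinearMap.BilinForm.even_finrank_of_isAlt {F W : Type*} [Field F] [CharZero F]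
    [AddCommGroup W] [Module F W] [FiniteDimensional F W] {B : LinearMap.BilinForm F W}
    (halt : B.IsAlt) (hB : B.Nondegenerate) : Even (Module.finrank F W) := by
  let b := Module.finBasis F W
  have hdet := (LinearMap.BilinForm.nondegenerate_iff_det_ne_zero b).1 hB
  set M := LinearMap.BilinForm.toMatrix b B with hM
  have hskew : M.transpose = -M := by
    ext i j
    simp [hM, LinearMap.BilinForm.toMatrix_apply, halt.neg_eq]
  have h := M.det_transpose
  rw [hskew, Matrix.det_neg, Fintype.card_fin] at h
  by_contra hodd
  rw [(Nat.not_even_iff_odd.1 hodd).neg_one_pow, neg_one_mul] at h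
  exact hdet (neg_eq_self.1 h)

/-- A real space with a complex structure and a nondegenerate, alternating, anti-invariant form
has dimension divisible by four. -/
theorem four_dvd_finrank_of_antiinvariant {W : Type*} [AddCommGroup W] [Module ℝ W]
    [FiniteDimensional ℝ W] (J : W →ₗ[ℝ] W) (hJ2 : ∀ v, J (J v) = -v)
    (α : W →ₗ[ℝ] W →ₗ[ℝ] ℝ) (halt : ∀ u, α u u = 0)
    (hanti : ∀ u v, α (J u) (J v) = -α u v)
    (hα : ∀ v, (∀ u, α u v = 0) → v = 0) :
    4 ∣ Module.finrank ℝ W := by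
  have hJJ : J * J = -1 := by ext v; simp [hJ2]
  let φ : ℂ →ₐ[ℝ] Module.End ℝ W := Complex.lift ⟨J, hJJ⟩
  let _ : Module ℂ W := Module.compHom W φ.toRingHom
  have hsmul (c : ℂ) (w : W) : c • w = c.re • w + c.im • J w := by
    change φ c w = _
    simp [φ, Complex.liftAux_apply, Module.algebraMap_end_apply]
  have : IsScalarTower ℝ ℂ W := ⟨fun r c w => by simp [hsmul, mul_smul]⟩
  have : FiniteDimensional ℂ W := FiniteDimensional.right ℝ ℂ W
  have hswap (u v : W) : α u (J v) = α (J u) v := by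
    have := hanti u (J v)
    rw [hJ2, map_neg] at this
    linarith
  have hneg (u v : W) : α u v = -α v u := by
    have := halt (u + v)
    simp only [map_add, LinearMap.add_apply, halt] at this
    linarith
  let β : LinearMap.BilinForm ℂ W := LinearMap.mk₂ ℂ
    (fun u v => (⟨α u v, -α (J u) v⟩ : ℂ))
    (fun u u' v => by apply Complex.ext <;> simp; ring)
    (fun c u v => by
      apply Complex.ext <;> simp [hsmul, hJ2]; ring)
    (fun u v v' => by apply Complex.ext <;> simp; ring)
    (fun c u v => by
      apply Complex.ext <;> simp [hsmul, hswap, hJ2]; ring)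
  have hβalt : β.IsAlt := fun u => by
    have : α (J u) u = 0 := by linarith [hswap u u, hneg u (J u)]
    simp [β, LinearMap.mk₂_apply, halt, this, Complex.ext_iff]
  have hright (v : W) (h : ∀ u, β u v = 0) : v = 0 :=
    hα v fun u => congrArg Complex.re (h u)
  have hβ : β.Nondegenerate :=
    ⟨fun u h => hright u fun v => by rw [← hβalt.neg_eq, h, neg_zero], hright⟩
  obtain ⟨k, hk⟩ := LinearMap.BilinForm.even_finrank_of_isAlt hβalt hβ
  rw [← Module.finrank_mul_finrank ℝ ℂ W, Complex.finrank_real_complex, hk]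
  exact ⟨k, by ring⟩

/-- The rank of `K_α` (the dimension of its range) is divisible by 4. -/
theorem rank_Kalpha_div_four
    {V : Type*} [NormedAddCommGroup V] [InnerProductSpace ℝ V] [FiniteDimensional ℝ V]
    (J : V →ₗ[ℝ] V)
    (hJ2 : ∀ v : V, J (J v) = -v)
    (hJorth : ∀ u v : V, ⟪J u, J v⟫ = ⟪u, v⟫)
    (α : V →ₗ[ℝ] V →ₗ[ℝ] ℝ)
    (halt : ∀ u : V, α u u = 0)
    (hanti : ∀ u v : V, α (J u) (J v) = -α u v)
    (K : V →ₗ[ℝ] V)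
    (hK : ∀ u v : V, ⟪u, K v⟫ = α u v) :
    4 ∣ Module.finrank ℝ (LinearMap.range K) := by
  have hKJ (v : V) : K (J v) = -J (K v) := by
    refine ext_inner_left ℝ fun u => ?_
    have h₁ := hanti u (J v)
    have h₂ := hJorth u (J (K v))
    rw [hJ2, map_neg] at h₁
    rw [hJ2, inner_neg_right, hK] at h₂
    rw [hK, inner_neg_right]
    linarith
  have hJrange : ∀ w ∈ LinearMap.range K, J w ∈ LinearMap.range K := by
    rintro _ ⟨v, rfl⟩
    exact ⟨-J v, by rw [map_neg, hKJ, neg_neg]⟩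
  have hneg (u v : V) : α u v = -α v u := by
    have := halt (u + v)
    simp only [map_add, LinearMap.add_apply, halt] at this
    linarith
  refine four_dvd_finrank_of_antiinvariant (J.restrict hJrange)
    (fun v => Subtype.ext (hJ2 v))
    (α.domRestrict₁₂ (LinearMap.range K) (LinearMap.range K))
    (fun u => halt u) (fun u v => hanti u v) ?_
  rintro ⟨_, w, rfl⟩ h
  have hKK : K (K w) = 0 := by
    have := h ⟨K (K w), K w, rfl⟩
    rw [LinearMap.domRestrict₁₂_apply, ← hK] at this
    exact inner_self_eq_zero.1 this
  have hKw : ⟪K w, K w⟫ = 0 := by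
    rw [hK, hneg, ← hK, hKK, inner_zero_right, neg_zero]
  exact Subtype.ext (inner_self_eq_zero.1 hKw)
end

section
/- If the J-anti-invariant 2-form α is not identically zero, then the real dimension of ker K_α is at most dim V − 4. -/
open RealInnerProductSpace

/-- A `2 × 2` homogeneous linear system with matrix `!![a, b; b, -a]`, `a ≠ 0`, has only the
trivial solution. -/
theorem eq_zero_and_eq_zero_of_symm_traceless {a b x y : ℝ} (ha : a ≠ 0)
    (h₁ : x * a + y * b = 0) (h₂ : x * b - y * a = 0) : x = 0 ∧ y = 0 := by
  have hpos : a ^ 2 + b ^ 2 ≠ 0 := by positivity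
  constructor
  · exact (mul_eq_zero.mp (by linear_combination a * h₁ + b * h₂ :
      x * (a ^ 2 + b ^ 2) = 0)).resolve_right hpos
  · exact (mul_eq_zero.mp (by linear_combination b * h₁ - a * h₂ :
      y * (a ^ 2 + b ^ 2) = 0)).resolve_right hpos

/-- If the `J`-anti-invariant 2-form `α` is not identically zero, then
the real dimension of `ker K_α` is at most `dim V - 4`. -/
theorem ker_Kalpha_dim_le_of_ne_zero
    {V : Type*} [NormedAddCommGroup V] [InnerProductSpace ℝ V] [FiniteDimensional ℝ V]
    (J : V →ₗ[ℝ] V)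
    (hJ2 : ∀ v : V, J (J v) = -v)
    (hJorth : ∀ u v : V, ⟪J u, J v⟫ = ⟪u, v⟫)
    (α : V →ₗ[ℝ] V →ₗ[ℝ] ℝ)
    (halt : ∀ u : V, α u u = 0)
    (hanti : ∀ u v : V, α (J u) (J v) = -α u v)
    (K : V →ₗ[ℝ] V)
    (hK : ∀ u v : V, ⟪u, K v⟫ = α u v)
    (hα : α ≠ 0) :
    Module.finrank ℝ (LinearMap.ker K) ≤ Module.finrank ℝ V - 4 := by
  obtain ⟨u, v, huv⟩ : ∃ u v, α u v ≠ 0 := by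
    by_contra! h
    exact hα (LinearMap.ext₂ h)
  have hskew : ∀ x y, α x y = -α y x := fun x y => by
    have h := halt (x + y)
    simp only [map_add, LinearMap.add_apply, halt] at h
    linarith
  have hswap : ∀ x y, α (J x) y = α x (J y) := fun x y => by
    have h := hanti x (J y)
    rw [hJ2, map_neg] at h
    linarith
  have hself : ∀ x, α x (J x) = 0 := fun x => by
    linarith [hswap x x, hskew (J x) x]
  have hli : LinearIndependent ℝ ![K u, K (J u), K v, K (J v)] := by
    rw [Fintype.linearIndependent_iff]
    intro c hc
    simp only [Fin.sum_univ_four, Matrix.cons_val] at hc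
    have key : ∀ w, c 0 * α w u + c 1 * α w (J u) + c 2 * α w v + c 3 * α w (J v) = 0 := fun w => by
      simpa [inner_add_right, inner_smul_right, hK] using congrArg (fun z => ⟪w, z⟫) hc
    have hu := key u
    have hJu := key (J u)
    have hv := key v
    have hJv := key (J v)
    simp only [hanti, halt, hself, hswap] at hu hJu hv hJv
    obtain ⟨h₂, h₃⟩ := eq_zero_and_eq_zero_of_symm_traceless (b := α u (J v)) (x := c 2)
      (y := c 3) huv (by linarith) (by linarith)
    have hvu : α v u ≠ 0 := by rwa [hskew, neg_ne_zero]
    obtain ⟨h₀, h₁⟩ := eq_zero_and_eq_zero_of_symm_traceless (b := α v (J u)) (x := c 0)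
      (y := c 1) hvu (by linarith) (by linarith)
    intro i
    fin_cases i <;> assumption
  have hrange : 4 ≤ Module.finrank ℝ (LinearMap.range K) := by
    rw [← Fintype.card_fin 4, ← finrank_span_eq_card hli]
    refine Submodule.finrank_mono (Submodule.span_le.mpr ?_)
    rintro _ ⟨i, rfl⟩
    fin_cases i <;> exact LinearMap.mem_range_self K _
  have := K.finrank_range_add_finrank_ker
  omega
end

section
/- If dim V = 2n with n odd, then ker K_α is nontrivial; equivalently, every J-anti-invariant 2-form on V is degenerate. -/
open RealInnerProductSpace

/-- An alternating bilinear form on an odd-dimensional space, in characteristic other than two,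
is degenerate. -/
theorem LinearMap.IsAlt.exists_ne_zero_of_odd_finrank {k W : Type*} [Field k] [NeZero (2 : k)]
    [AddCommGroup W] [Module k W] [FiniteDimensional k W] {β : W →ₗ[k] W →ₗ[k] k}
    (hβ : β.IsAlt) (hodd : Odd (Module.finrank k W)) :
    ∃ u : W, u ≠ 0 ∧ ∀ w, β u w = 0 := by
  let b := Module.finBasis k W
  let M : Matrix (Fin (Module.finrank k W)) (Fin (Module.finrank k W)) k :=
    Matrix.of fun i j => β (b i) (b j)
  have hM : M.transpose = -M := by
    ext i j
    simpa [M] using (hβ.neg (b i) (b j)).symm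
  have hdet : M.det = 0 := by
    have h := congrArg Matrix.det hM
    rw [Matrix.det_transpose, Matrix.det_neg, Fintype.card_fin, hodd.neg_one_pow] at h
    have h2 : 2 * M.det = 0 := by linear_combination h
    exact (mul_eq_zero.mp h2).resolve_left two_ne_zero
  obtain ⟨v, hv0, hv⟩ := Matrix.exists_vecMul_eq_zero_iff.mpr hdet
  refine ⟨∑ i, v i • b i, fun h => hv0 ?_, fun w => ?_⟩
  · ext i
    exact Fintype.linearIndependent_iff.mp b.linearIndependent v h i
  · suffices h : β (∑ i, v i • b i) = 0 by rw [h, LinearMap.zero_apply]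
    refine b.ext fun j => ?_
    simpa [M, Matrix.vecMul, dotProduct] using congrFun hv j

/-- An alternating real form that is anti-invariant under a complex structure is degenerate
when the complex dimension is odd. -/
theorem LinearMap.IsAlt.exists_ne_zero_of_antiInvariant {V : Type*} [AddCommGroup V] [Module ℝ V]
    [FiniteDimensional ℝ V] {α : V →ₗ[ℝ] V →ₗ[ℝ] ℝ} (halt : α.IsAlt) {J : V →ₗ[ℝ] V}
    (hJ2 : ∀ v, J (J v) = -v) (hanti : ∀ u v, α (J u) (J v) = -α u v)
    {n : ℕ} (hn : Odd n) (hdim : Module.finrank ℝ V = 2 * n) :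
    ∃ u : V, u ≠ 0 ∧ ∀ w, α u w = 0 := by
  let φ : ℂ →ₐ[ℝ] Module.End ℝ V := Complex.lift ⟨J, LinearMap.ext fun v => by simp [hJ2]⟩
  let : Module ℂ V := Module.compHom V φ.toRingHom
  have smul_def (z : ℂ) (v : V) : z • v = z.re • v + z.im • J v := by
    change φ z v = _
    simp [φ, Complex.liftAux_apply]
  have : IsScalarTower ℝ ℂ V := ⟨fun r z v => by
    simp [smul_def, smul_add, mul_smul]⟩
  have : FiniteDimensional ℂ V := FiniteDimensional.right ℝ ℂ V
  have hfin : Module.finrank ℂ V = n := by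
    have h := Module.finrank_mul_finrank ℝ ℂ V
    rw [Complex.finrank_real_complex, hdim] at h
    omega
  have hJ_swap (u v : V) : α (J u) v = α u (J v) := by
    have h := hanti u (J v)
    rw [hJ2, map_neg] at h
    linarith
  let β : V →ₗ[ℂ] V →ₗ[ℂ] ℂ := LinearMap.mk₂ ℂ (fun u v => ⟨α u v, -α (J u) v⟩)
    (fun u u' v => by apply Complex.ext <;> simp [add_comm])
    (fun z u v => by
      apply Complex.ext <;> simp [smul_def, hJ2] <;> ring)
    (fun u v v' => by apply Complex.ext <;> simp [add_comm])
    (fun z u v => by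
      apply Complex.ext <;> simp [smul_def, hJ2, hJ_swap] <;> ring)
  have hβ : β.IsAlt := fun u => by
    have h : α (J u) u = 0 := by
      have h1 := hJ_swap u u
      have h2 := halt.neg u (J u)
      linarith
    apply Complex.ext <;> simp [β, h, halt u]
  obtain ⟨u, hu, h⟩ := hβ.exists_ne_zero_of_odd_finrank (hfin ▸ hn)
  exact ⟨u, hu, fun w => congrArg Complex.re (h w)⟩

/-- If `dim V = 2n` with `n` odd, then `ker K_α` is nontrivial;
equivalently, every `J`-anti-invariant 2-form on `V` is degenerate. -/
theorem ker_Kalpha_nontrivial_of_odd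
    {V : Type*} [NormedAddCommGroup V] [InnerProductSpace ℝ V] [FiniteDimensional ℝ V]
    (J : V →ₗ[ℝ] V)
    (hJ2 : ∀ v : V, J (J v) = -v)
    (hJorth : ∀ u v : V, ⟪J u, J v⟫ = ⟪u, v⟫)
    (α : V →ₗ[ℝ] V →ₗ[ℝ] ℝ)
    (halt : ∀ u : V, α u u = 0)
    (hanti : ∀ u v : V, α (J u) (J v) = -α u v)
    (K : V →ₗ[ℝ] V)
    (hK : ∀ u v : V, ⟪u, K v⟫ = α u v)
    (n : ℕ) (hn : Odd n)
    (hdim : Module.finrank ℝ V = 2 * n) :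
    LinearMap.ker K ≠ ⊥ ∧ ∃ u : V, u ≠ 0 ∧ ∀ w : V, α u w = 0 := by
  obtain ⟨u, hu, h⟩ := LinearMap.IsAlt.exists_ne_zero_of_antiInvariant halt hJ2 hanti hn hdim
  refine ⟨(Submodule.ne_bot_iff _).mpr ⟨u, ?_, hu⟩, u, hu, h⟩
  refine LinearMap.mem_ker.mpr (ext_inner_left ℝ fun w => ?_)
  rw [hK, inner_zero_right, ← LinearMap.IsAlt.neg halt u w, h, neg_zero]
end

section
/- If dim V = 6 and the J-anti-invariant 2-form α is not identically zero, then the kernel of K_α has real dimension exactly 2. -/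
open RealInnerProductSpace

section AntiInvariant

variable {V : Type*} [AddCommGroup V] [Module ℝ V]

/-- The pairings of a vector with `u`, `J u`, `v` and `J v` under `α`. -/
noncomputable def pairingMap (J : V →ₗ[ℝ] V) (α : V →ₗ[ℝ] V →ₗ[ℝ] ℝ) (u v : V) :
    V →ₗ[ℝ] (ℝ × ℝ) × (ℝ × ℝ) :=
  ((α.flip u).prod (α.flip (J u))).prod ((α.flip v).prod (α.flip (J v)))

variable {J : V →ₗ[ℝ] V} {α : V →ₗ[ℝ] V →ₗ[ℝ] ℝ}

lemma pairingMap_apply (u v w : V) :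
    pairingMap J α u v w = ((α w u, α w (J u)), (α w v, α w (J v))) := rfl

lemma mem_ker_pairingMap {u v w : V} :
    w ∈ LinearMap.ker (pairingMap J α u v) ↔
      (α w u = 0 ∧ α w (J u) = 0) ∧ (α w v = 0 ∧ α w (J v) = 0) := by
  simp [pairingMap_apply]

lemma apply_swap_of_alternating (halt : ∀ u : V, α u u = 0) (u v : V) : α u v = -α v u := by
  have h := halt (u + v)
  simp only [map_add, LinearMap.add_apply, halt] at h
  linarith

lemma antiInvariant_apply_left (hJ2 : ∀ v : V, J (J v) = -v)
    (hanti : ∀ u v : V, α (J u) (J v) = -α u v) (u v : V) : α (J u) v = α u (J v) := by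
  have h := hanti u (J v)
  rw [hJ2, map_neg] at h
  linarith

lemma antiInvariant_apply_self (hJ2 : ∀ v : V, J (J v) = -v) (halt : ∀ u : V, α u u = 0)
    (hanti : ∀ u v : V, α (J u) (J v) = -α u v) (u : V) : α u (J u) = 0 := by
  have h := antiInvariant_apply_left hJ2 hanti u u
  have h' := apply_swap_of_alternating halt u (J u)
  linarith

/-- If `α u v ≠ 0`, then any `J`-invariant subspace containing `u` and `v` is mapped onto the
whole target by the pairings with `u`, `J u`, `v`, `J v`. -/
lemma exists_mem_pairingMap_eq (hJ2 : ∀ v : V, J (J v) = -v) (halt : ∀ u : V, α u u = 0)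
    (hanti : ∀ u v : V, α (J u) (J v) = -α u v) {N : Submodule ℝ V}
    (hN : ∀ x ∈ N, J x ∈ N) {u v : V} (hu : u ∈ N) (hv : v ∈ N) (huv : α u v ≠ 0)
    (t : (ℝ × ℝ) × (ℝ × ℝ)) : ∃ y ∈ N, pairingMap J α u v y = t := by
  obtain ⟨⟨p, q⟩, r, s⟩ := t
  have hD : α u v ^ 2 + α u (J v) ^ 2 ≠ 0 := by positivity
  have e1 : α v u = -α u v := apply_swap_of_alternating halt v u
  have e2 : α (J u) v = α u (J v) := antiInvariant_apply_left hJ2 hanti u v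
  have e3 : α (J v) u = -α u (J v) := apply_swap_of_alternating halt _ _
  have e4 : α v (J u) = -α u (J v) := by rw [apply_swap_of_alternating halt, e2]
  have e5 := antiInvariant_apply_self hJ2 halt hanti u
  have e6 := antiInvariant_apply_self hJ2 halt hanti v
  have e7 : α (J u) u = 0 := by rw [apply_swap_of_alternating halt, e5, neg_zero]
  have e8 : α (J v) v = 0 := by rw [apply_swap_of_alternating halt, e6, neg_zero]
  refine ⟨((α u v * r + α u (J v) * s) / (α u v ^ 2 + α u (J v) ^ 2)) • u
    + ((α u (J v) * r - α u v * s) / (α u v ^ 2 + α u (J v) ^ 2)) • J u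
    + (-(α u v * p + α u (J v) * q) / (α u v ^ 2 + α u (J v) ^ 2)) • v
    + ((α u v * q - α u (J v) * p) / (α u v ^ 2 + α u (J v) ^ 2)) • J v, ?_, ?_⟩
  · exact N.add_mem (N.add_mem (N.add_mem (N.smul_mem _ hu) (N.smul_mem _ (hN u hu)))
      (N.smul_mem _ hv)) (N.smul_mem _ (hN v hv))
  · rw [pairingMap_apply]
    simp only [map_add, map_smul, LinearMap.add_apply, LinearMap.smul_apply, smul_eq_mul, hanti, halt,
      e1, e2, e3, e4, e5, e6, e7, e8, Prod.mk.injEq]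
    refine ⟨⟨?_, ?_⟩, ?_, ?_⟩ <;> field_simp <;> ring

lemma ker_pairingMap_invariant (hJ2 : ∀ v : V, J (J v) = -v)
    (hanti : ∀ u v : V, α (J u) (J v) = -α u v) {u v x : V}
    (hx : x ∈ LinearMap.ker (pairingMap J α u v)) :
    J x ∈ LinearMap.ker (pairingMap J α u v) := by
  rw [mem_ker_pairingMap] at hx ⊢
  simpa [antiInvariant_apply_left hJ2 hanti, hJ2, and_comm] using hx

lemma finrank_ker_pairingMap [FiniteDimensional ℝ V] (hJ2 : ∀ v : V, J (J v) = -v)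
    (halt : ∀ u : V, α u u = 0) (hanti : ∀ u v : V, α (J u) (J v) = -α u v) {u v : V}
    (huv : α u v ≠ 0) :
    4 + Module.finrank ℝ (LinearMap.ker (pairingMap J α u v)) = Module.finrank ℝ V := by
  have hsurj : LinearMap.range (pairingMap J α u v) = ⊤ := LinearMap.range_eq_top.2 fun t ↦
    (exists_mem_pairingMap_eq hJ2 halt hanti (N := ⊤) (by simp) trivial trivial huv t).imp
      fun _ h ↦ h.2
  have h := (pairingMap J α u v).finrank_range_add_finrank_ker
  rwa [hsurj, finrank_top, Module.finrank_prod, Module.finrank_prod, Module.finrank_self] at h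

/-- A `J`-anti-invariant 2-form vanishes on `J`-invariant subspaces of dimension less than four. -/
lemma antiInvariant_eq_zero_of_finrank_lt [FiniteDimensional ℝ V] (hJ2 : ∀ v : V, J (J v) = -v)
    (halt : ∀ u : V, α u u = 0) (hanti : ∀ u v : V, α (J u) (J v) = -α u v) {N : Submodule ℝ V}
    (hN : ∀ x ∈ N, J x ∈ N) (hdim : Module.finrank ℝ N < 4) {x y : V} (hx : x ∈ N) (hy : y ∈ N) :
    α x y = 0 := by
  by_contra hxy
  have hsurj : Function.Surjective ((pairingMap J α x y).domRestrict N) := fun t ↦ by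
    obtain ⟨z, hz, h⟩ := exists_mem_pairingMap_eq hJ2 halt hanti hN hx hy hxy t
    exact ⟨⟨z, hz⟩, h⟩
  have h := LinearMap.finrank_le_finrank_of_surjective hsurj
  rw [Module.finrank_prod, Module.finrank_prod, Module.finrank_self] at h
  omega

end AntiInvariant

/-- If `dim V = 6` and the `J`-anti-invariant 2-form `α` is not
identically zero, then the kernel of `K_α` has real dimension exactly 2. -/
theorem ker_Kalpha_dim_two_of_dim_six
    {V : Type*} [NormedAddCommGroup V] [InnerProductSpace ℝ V] [FiniteDimensional ℝ V]
    (J : V →ₗ[ℝ] V)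
    (hJ2 : ∀ v : V, J (J v) = -v)
    (hJorth : ∀ u v : V, ⟪J u, J v⟫ = ⟪u, v⟫)
    (α : V →ₗ[ℝ] V →ₗ[ℝ] ℝ)
    (halt : ∀ u : V, α u u = 0)
    (hanti : ∀ u v : V, α (J u) (J v) = -α u v)
    (K : V →ₗ[ℝ] V)
    (hK : ∀ u v : V, ⟪u, K v⟫ = α u v)
    (hdim : Module.finrank ℝ V = 6)
    (hα : α ≠ 0) :
    Module.finrank ℝ (LinearMap.ker K) = 2 := by
  obtain ⟨u, v, huv⟩ : ∃ u v, α u v ≠ 0 := by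
    by_contra! h
    exact hα (LinearMap.ext₂ h)
  have hrank := finrank_ker_pairingMap hJ2 halt hanti huv
  suffices LinearMap.ker K = LinearMap.ker (pairingMap J α u v) by
    rw [this]
    omega
  ext w
  refine ⟨fun hw ↦ ?_, fun hw ↦ ?_⟩
  · have h (x : V) : α w x = 0 := by
      rw [apply_swap_of_alternating halt, ← hK, LinearMap.mem_ker.1 hw, inner_zero_right, neg_zero]
    exact mem_ker_pairingMap.2 ⟨⟨h u, h _⟩, h v, h _⟩
  · refine LinearMap.mem_ker.2 (ext_inner_left ℝ fun x ↦ ?_)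
    rw [hK, inner_zero_right]
    -- Split `x = y + (x - y)` with `y` in the span of `u, J u, v, J v` and `x - y` in the kernel.
    have hwN := mem_ker_pairingMap.1 hw
    let N : Submodule ℝ V := LinearMap.ker (α w) ⊓ LinearMap.ker ((α w).comp J)
    have hN : ∀ x ∈ N, J x ∈ N := fun x hx ↦ by
      simpa [N, hJ2, and_comm] using hx
    obtain ⟨y, hyN, hy⟩ := exists_mem_pairingMap_eq hJ2 halt hanti hN
      (u := u) (v := v) hwN.1 hwN.2 huv (pairingMap J α u v x)
    have hxy : x - y ∈ LinearMap.ker (pairingMap J α u v) := by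
      rw [LinearMap.mem_ker, map_sub, hy, sub_self]
    have h1 := antiInvariant_eq_zero_of_finrank_lt hJ2 halt hanti
      (fun _ ↦ ker_pairingMap_invariant hJ2 hanti) (by omega) hxy hw
    have h2 : α w y = 0 := hyN.1
    rw [map_sub, LinearMap.sub_apply, apply_swap_of_alternating halt y w, h2] at h1
    linarith
end

section
/- The composite J ∘ K_α is skew-adjoint, and the endomorphism id + J ∘ K_α of V is invertible. -/
open RealInnerProductSpace

/-- A skew-adjoint endomorphism `A` of a finite-dimensional real inner product space has no
eigenvalue `-1`, so `1 + A` is invertible. -/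
theorem isUnit_one_add_of_skew_adjoint
    {V : Type*} [NormedAddCommGroup V] [InnerProductSpace ℝ V] [FiniteDimensional ℝ V]
    (A : Module.End ℝ V) (hA : ∀ u v : V, ⟪A u, v⟫ = -⟪u, A v⟫) : IsUnit (1 + A) := by
  rw [LinearMap.isUnit_iff_ker_eq_bot, LinearMap.ker_eq_bot']
  intro u hu
  have hAu : ⟪A u, u⟫ = 0 := by
    have h := hA u u
    rw [real_inner_comm (A u) u] at h
    linarith
  have hsum : ⟪u + A u, u⟫ = 0 := by
    have hu' : u + A u = 0 := hu
    rw [hu', inner_zero_left]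
  rw [inner_add_left, hAu, add_zero] at hsum
  exact inner_self_eq_zero.mp hsum

/-- The composite `J ∘ K_α` is skew-adjoint, and the endomorphism
`id + J ∘ K_α` of `V` is invertible. -/
theorem JK_skew_adjoint_and_id_add_JK_invertible
    {V : Type*} [NormedAddCommGroup V] [InnerProductSpace ℝ V] [FiniteDimensional ℝ V]
    (J : Module.End ℝ V)
    (hJ2 : ∀ v : V, J (J v) = -v)
    (hJorth : ∀ u v : V, ⟪J u, J v⟫ = ⟪u, v⟫)
    (α : V →ₗ[ℝ] V →ₗ[ℝ] ℝ)
    (halt : ∀ u : V, α u u = 0)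
    (hanti : ∀ u v : V, α (J u) (J v) = -α u v)
    (K : Module.End ℝ V)
    (hK : ∀ u v : V, ⟪u, K v⟫ = α u v) :
    (∀ u v : V, ⟪(J * K) u, v⟫ = -⟪u, (J * K) v⟫) ∧
      IsUnit (1 + J * K) := by
  have hJskew (u v : V) : ⟪J u, v⟫ = -⟪u, J v⟫ := by
    rw [← hJorth (J u) v, hJ2, inner_neg_left]
  have hαJ (u v : V) : α (J u) v = α u (J v) := by
    have h := hanti (J u) v
    rw [hJ2, map_neg, LinearMap.neg_apply] at h
    linarith
  have hskew (u v : V) : ⟪(J * K) u, v⟫ = -⟪u, (J * K) v⟫ := by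
    simp only [Module.End.mul_apply]
    calc ⟪J (K u), v⟫ = -α (J v) u := by rw [hJskew, real_inner_comm, hK]
      _ = α u (J v) := LinearMap.IsAlt.neg halt (J v) u
      _ = -⟪u, J (K v)⟫ := by rw [← hαJ, ← hK, hJskew]
  exact ⟨hskew, isUnit_one_add_of_skew_adjoint _ hskew⟩
end

section
/- Let W be a real vector space with a complex structure j (j ∘ j = −id) and let L : W → V be a linear map. Write ∂̄_J L := (1/2)(L + J ∘ L ∘ j) and ∂_J L := (1/2)(L − J ∘ L ∘ j), and similarly ∂̄_{J_α} L := (1/2)(L + J_α ∘ L ∘ j). Then ∂̄_{J_α} L = 0 if and only if ∂̄_J L = K_α ∘ (∂_J L) ∘ j. -/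
open RealInnerProductSpace

/-- With `∂̄_J L := (1/2)(L + J ∘ L ∘ j)`, `∂_J L := (1/2)(L - J ∘ L ∘ j)`
and `∂̄_{J_α} L := (1/2)(L + J_α ∘ L ∘ j)`, one has
`∂̄_{J_α} L = 0 ↔ ∂̄_J L = K_α ∘ (∂_J L) ∘ j`. -/
theorem dbar_Jalpha_eq_zero_iff
    {V : Type*} [NormedAddCommGroup V] [InnerProductSpace ℝ V] [FiniteDimensional ℝ V]
    (J : Module.End ℝ V)
    (hJ2 : ∀ v : V, J (J v) = -v)
    (hJorth : ∀ u v : V, ⟪J u, J v⟫ = ⟪u, v⟫)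
    (α : V →ₗ[ℝ] V →ₗ[ℝ] ℝ)
    (halt : ∀ u : V, α u u = 0)
    (hanti : ∀ u v : V, α (J u) (J v) = -α u v)
    (K : Module.End ℝ V)
    (hK : ∀ u v : V, ⟪u, K v⟫ = α u v)
    (hinv : IsUnit (1 + J * K))
    (Jα : Module.End ℝ V)
    (hJα : Jα = Ring.inverse (1 + J * K) * J * (1 + J * K))
    {W : Type*} [AddCommGroup W] [Module ℝ W]
    (j : Module.End ℝ W)
    (hj : j * j = -1)
    (L : W →ₗ[ℝ] V) :
    ((1 : ℝ) / 2) • (L + (Jα ∘ₗ L) ∘ₗ j) = 0 ↔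
      ((1 : ℝ) / 2) • (L + (J ∘ₗ L) ∘ₗ j) =
        (K ∘ₗ (((1 : ℝ) / 2) • (L - (J ∘ₗ L) ∘ₗ j))) ∘ₗ j := by
  have hKJ : ∀ v, K (J v) = -J (K v) := fun v => by
    refine ext_inner_left ℝ fun u => ?_
    have h := hanti (J u) v
    rw [hJ2, map_neg, LinearMap.neg_apply, neg_inj, ← hK, ← hK] at h
    rw [h, ← hJorth (J u), hJ2, inner_neg_left, inner_neg_right]
  have hconj : (1 + J * K) * Jα = J * (1 + J * K) := by
    rw [hJα, ← mul_assoc, ← mul_assoc, Ring.mul_inverse_cancel _ hinv, one_mul]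
  have hinj : Function.Injective (1 + J * K : Module.End ℝ V) :=
    ((Module.End.isUnit_iff _).mp hinv).injective
  have hjj : ∀ w, j (j w) = -w := fun w => by simpa using LinearMap.congr_fun hj w
  have h2 : ((1 : ℝ) / 2) ≠ 0 := by norm_num
  rw [LinearMap.comp_smul, LinearMap.smul_comp, smul_right_inj h2, smul_eq_zero_iff_right h2,
    LinearMap.ext_iff, LinearMap.ext_iff]
  refine forall_congr' fun w => ?_
  have hc : Jα (L (j w)) + J (K (Jα (L (j w)))) = J (L (j w)) - K (L (j w)) := by
    simpa [hJ2, sub_eq_add_neg] using LinearMap.congr_fun hconj (L (j w))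
  rw [← hinj.eq_iff, LinearMap.zero_apply, map_zero, ← sub_eq_zero (b := ((K ∘ₗ (L - (J ∘ₗ L) ∘ₗ j)) ∘ₗ j) w)]
  refine Eq.congr_left ?_
  simp only [LinearMap.add_apply, LinearMap.comp_apply, LinearMap.sub_apply, map_add, map_sub,
    Module.End.mul_apply, Module.End.one_apply, hjj, map_neg, hKJ]
  linear_combination (norm := module) hc
end

section
/- Let W be a real vector space with a complex structure j (j ∘ j = −id) and let L : W → V be a linear map which is (j, J_α)-complex-linear, i.e. L ∘ j = J_α ∘ L. Then for every e ∈ W one has α(L e, L(j e)) = (1/2)·‖L e + J(L(j e))‖². In particular α(L e, L(j e)) ≥ 0 for every e ∈ W. -/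
open RealInnerProductSpace

/-- If `L : W → V` is `(j, J_α)`-complex-linear, then for every `e ∈ W`
one has `α(L e, L (j e)) = (1/2) ‖L e + J (L (j e))‖²`.  In particular
`α(L e, L (j e)) ≥ 0` for every `e ∈ W`. -/
theorem alpha_of_Jalpha_linear
    {V : Type*} [NormedAddCommGroup V] [InnerProductSpace ℝ V] [FiniteDimensional ℝ V]
    (J : Module.End ℝ V)
    (hJ2 : ∀ v : V, J (J v) = -v)
    (hJorth : ∀ u v : V, ⟪J u, J v⟫ = ⟪u, v⟫)
    (α : V →ₗ[ℝ] V →ₗ[ℝ] ℝ)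
    (halt : ∀ u : V, α u u = 0)
    (hanti : ∀ u v : V, α (J u) (J v) = -α u v)
    (K : Module.End ℝ V)
    (hK : ∀ u v : V, ⟪u, K v⟫ = α u v)
    (hinv : IsUnit (1 + J * K))
    (Jα : Module.End ℝ V)
    (hJα : Jα = Ring.inverse (1 + J * K) * J * (1 + J * K))
    {W : Type*} [AddCommGroup W] [Module ℝ W]
    (j : Module.End ℝ W)
    (hj : j * j = -1)
    (L : W →ₗ[ℝ] V)
    (hL : L ∘ₗ j = Jα ∘ₗ L) :
    (∀ e : W, α (L e) (L (j e)) = (1 / 2) * ‖L e + J (L (j e))‖ ^ 2) ∧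
      (∀ e : W, 0 ≤ α (L e) (L (j e))) := by
  have hskew (u v : V) : α v u = -α u v := by
    have h := halt (u + v)
    simp only [map_add, LinearMap.add_apply, halt] at h
    linarith
  have hJself (u : V) : α (J u) u = 0 := by
    have h := hanti u (J u)
    rw [hJ2, map_neg, hskew (J u) u] at h
    linarith
  have main (e : W) : α (L e) (L (j e)) = (1 / 2) * ‖L e + J (L (j e))‖ ^ 2 := by
    have hLe : L (j e) = Jα (L e) := LinearMap.congr_fun hL e
    have hconj : (1 + J * K) * Jα = J * (1 + J * K) := by
      rw [hJα, mul_assoc, Ring.mul_inverse_cancel_left _ _ hinv]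
    have hcomm := LinearMap.congr_fun hconj (L e)
    rw [Module.End.mul_apply, ← hLe] at hcomm
    generalize L (j e) = v at *
    generalize L e = u at *
    simp only [Module.End.mul_apply, LinearMap.add_apply, Module.End.one_apply, map_add, hJ2]
      at hcomm
    have hw : u + J v = K v - J (K u) := by
      have h := congrArg J hcomm
      simp only [map_add, map_neg, hJ2] at h
      linear_combination (norm := module) h
    have hsq : ‖u + J v‖ ^ 2 = α (u + J v) v + α (J (u + J v)) u := by
      rw [← real_inner_self_eq_norm_sq]
      nth_rewrite 2 [hw]
      rw [inner_sub_right, hK, ← hJorth (u + J v) (J (K u)), hJ2, inner_neg_right, hK,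
        sub_neg_eq_add]
    simp only [map_add, LinearMap.add_apply, hJ2, map_neg, LinearMap.neg_apply, hJself] at hsq
    linarith [hskew u v]
  exact ⟨main, fun e => by rw [main e]; positivity⟩
end

section
/- Let W be a real vector space with a complex structure j (j ∘ j = −id) and let L : W → V be a linear map with L ∘ j = J_α ∘ L. If α(L e, L(j e)) = 0 for every e ∈ W, then L is (j, J)-complex-linear (L ∘ j = J ∘ L) and K_α ∘ L = 0. -/
open RealInnerProductSpace

/-- If `L : W → V` is `(j, J_α)`-complex-linear and
`α(L e, L (j e)) = 0` for every `e ∈ W`, then `L` is `(j, J)`-complex-linear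
(`L ∘ j = J ∘ L`) and `K_α ∘ L = 0`. -/
theorem J_linear_and_K_comp_eq_zero_of_alpha_vanishes
    {V : Type*} [NormedAddCommGroup V] [InnerProductSpace ℝ V] [FiniteDimensional ℝ V]
    (J : Module.End ℝ V)
    (hJ2 : ∀ v : V, J (J v) = -v)
    (hJorth : ∀ u v : V, ⟪J u, J v⟫ = ⟪u, v⟫)
    (α : V →ₗ[ℝ] V →ₗ[ℝ] ℝ)
    (halt : ∀ u : V, α u u = 0)
    (hanti : ∀ u v : V, α (J u) (J v) = -α u v)
    (K : Module.End ℝ V)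
    (hK : ∀ u v : V, ⟪u, K v⟫ = α u v)
    (hinv : IsUnit (1 + J * K))
    (Jα : Module.End ℝ V)
    (hJα : Jα = Ring.inverse (1 + J * K) * J * (1 + J * K))
    {W : Type*} [AddCommGroup W] [Module ℝ W]
    (j : Module.End ℝ W)
    (hj : j * j = -1)
    (L : W →ₗ[ℝ] V)
    (hL : L ∘ₗ j = Jα ∘ₗ L)
    (hvan : ∀ e : W, α (L e) (L (j e)) = 0) :
    L ∘ₗ j = J ∘ₗ L ∧ K ∘ₗ L = 0 := by
  have hcomm (u v : V) : α (J u) v = α u (J v) := by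
    have h := hanti u (J v)
    rw [hJ2, map_neg] at h
    linarith
  have hskew (u v : V) : α u v = -α v u := by
    have h := halt (u + v)
    simp only [map_add, LinearMap.add_apply, halt] at h
    linarith
  have hJskew (u v : V) : ⟪u, J v⟫ = -⟪J u, v⟫ := by
    have h := hJorth u (J v)
    rw [hJ2, inner_neg_right] at h
    linarith
  have hself (u : V) : α u (J u) = 0 := by
    linarith [hcomm u u, hskew (J u) u]
  have hKJ (v : V) : K (J v) = -J (K v) := by
    refine ext_inner_left ℝ fun u => ?_
    rw [hK, ← hcomm, inner_neg_right, hJskew, neg_neg, hK]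
  have hconj (u : V) : Jα u + J (K (Jα u)) = J u - K u := by
    have h : (1 + J * K) * Jα = J * (1 + J * K) := by
      rw [hJα, ← mul_assoc, ← mul_assoc, Ring.mul_inverse_cancel _ hinv, one_mul]
    simpa [hJ2, sub_eq_add_neg] using LinearMap.congr_fun h u
  have hLj (e : W) : L (j e) = Jα (L e) := LinearMap.congr_fun hL e
  -- the difference `v - J u` of the two candidate images is `-J K (v + J u)`
  have hdiff (e : W) : L (j e) - J (L e) = -J (K (L (j e) + J (L e))) := by
    have h := hconj (L e)
    rw [← hLj] at h
    rw [map_add, hKJ, map_add, map_neg, hJ2, neg_neg]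
    linear_combination (norm := module) h
  have hJL (e : W) : L (j e) = J (L e) := by
    rw [← sub_eq_zero, ← inner_self_eq_zero (𝕜 := ℝ)]
    nth_rw 2 [hdiff]
    rw [inner_neg_right, hJskew, neg_neg, hK, map_sub, hJ2]
    simp only [map_add, map_sub, map_neg, LinearMap.sub_apply, LinearMap.neg_apply]
    linarith [hcomm (L (j e)) (L (j e)), hself (L (j e)), hself (L e), hvan e,
      hanti (L (j e)) (L e), hskew (L (j e)) (L e)]
  have hKLj (e : W) : K (L (j e)) = 0 := by
    have h := hdiff e
    rw [← hJL, sub_self, ← two_smul ℝ, map_smul, map_smul, eq_comm, neg_eq_zero,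
      smul_eq_zero_iff_right two_ne_zero] at h
    simpa [h] using hJ2 (K (L (j e)))
  refine ⟨LinearMap.ext hJL, LinearMap.ext fun e => ?_⟩
  have hjj : j (j e) = -e := LinearMap.congr_fun hj e
  simpa [hjj] using hKLj (j e)
end

section
/- Define the symplectic form ω(u, v) := ⟨J u, v⟩ on V. Then there exists t₀ > 0 such that for every real t with 0 < t < t₀, the complex structure J_{tα} := (id + t·J ∘ K_α)⁻¹ ∘ J ∘ (id + t·J ∘ K_α) is ω-tamed, i.e. ω(u, J_{tα} u) > 0 for every nonzero u ∈ V. -/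
open RealInnerProductSpace

section

variable {V : Type*} [NormedAddCommGroup V] [InnerProductSpace ℝ V]

/-- The endomorphism representing a `J`-anti-invariant form anticommutes with `J`. -/
theorem anticommute_of_antiInvariant {J K : Module.End ℝ V}
    {α : V →ₗ[ℝ] V →ₗ[ℝ] ℝ} (hJ2 : ∀ v : V, J (J v) = -v)
    (hJorth : ∀ u v : V, ⟪J u, J v⟫ = ⟪u, v⟫)
    (hanti : ∀ u v : V, α (J u) (J v) = -α u v)
    (hK : ∀ u v : V, ⟪u, K v⟫ = α u v) (v : V) : K (J v) = -J (K v) := by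
  refine ext_inner_left ℝ fun u => ?_
  obtain ⟨u, rfl⟩ : ∃ u', J u' = u := ⟨-J u, by rw [map_neg, hJ2, neg_neg]⟩
  rw [hK, hanti, inner_neg_right, hJorth, hK]

/-- If `K` represents a `J`-anti-invariant `2`-form, then `⟪v, J (K v)⟫ = 0` for all `v`. -/
theorem inner_self_comp_eq_zero {J K : Module.End ℝ V}
    {α : V →ₗ[ℝ] V →ₗ[ℝ] ℝ} (hJ2 : ∀ v : V, J (J v) = -v)
    (hJorth : ∀ u v : V, ⟪J u, J v⟫ = ⟪u, v⟫)
    (halt : ∀ u : V, α u u = 0)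
    (hanti : ∀ u v : V, α (J u) (J v) = -α u v)
    (hK : ∀ u v : V, ⟪u, K v⟫ = α u v) (v : V) : ⟪v, J (K v)⟫ = 0 := by
  have h₁ : ⟪v, J (K v)⟫ = -α (J v) v := by
    rw [← hJorth, hJ2, inner_neg_right, hK]
  have h₂ : ⟪v, J (K v)⟫ = -α v (J v) := by
    rw [← hK, anticommute_of_antiInvariant hJ2 hJorth hanti hK, inner_neg_right, neg_neg]
  have h₃ : α (J v) v + α v (J v) = 0 := by
    have h := halt (J v + v)
    simp only [map_add, LinearMap.add_apply, halt] at h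
    linarith
  linarith

/-- `1 + t • A` is invertible when `⟪v, A v⟫ = 0` for all `v`. -/
theorem isUnit_one_add_smul_of_inner_self_eq_zero [FiniteDimensional ℝ V]
    {A : Module.End ℝ V} (hA : ∀ v : V, ⟪v, A v⟫ = 0) (t : ℝ) : IsUnit (1 + t • A) := by
  rw [LinearMap.isUnit_iff_ker_eq_bot, LinearMap.ker_eq_bot']
  intro v hv
  have h : ⟪v, (1 + t • A) v⟫ = ⟪v, v⟫ := by
    simp [inner_add_right, inner_smul_right, hA]
  rw [hv, inner_zero_right] at h
  exact inner_self_eq_zero.mp h.symm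

/-- Two vectors whose difference is shorter than their sum have positive inner product. -/
theorem inner_pos_of_norm_sub_lt_norm_add {x y : V} (h : ‖y - x‖ < ‖y + x‖) : 0 < ⟪x, y⟫ := by
  have h₁ := norm_add_sq_real y x
  have h₂ := norm_sub_sq_real y x
  have h₃ : ‖y - x‖ ^ 2 < ‖y + x‖ ^ 2 := by gcongr
  rw [real_inner_comm]
  linarith

end

/-- With the symplectic form `ω(u, v) := ⟪J u, v⟫` on `V`, there exists
`t₀ > 0` such that for every real `t` with `0 < t < t₀` the complex structure
`J_{tα} := (id + t·J ∘ K_α)⁻¹ ∘ J ∘ (id + t·J ∘ K_α)` is `ω`-tamed, i.e.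
`ω(u, J_{tα} u) > 0` for every nonzero `u ∈ V`. -/
theorem Jtalpha_tamed_for_small_t
    {V : Type*} [NormedAddCommGroup V] [InnerProductSpace ℝ V] [FiniteDimensional ℝ V]
    (J : Module.End ℝ V)
    (hJ2 : ∀ v : V, J (J v) = -v)
    (hJorth : ∀ u v : V, ⟪J u, J v⟫ = ⟪u, v⟫)
    (α : V →ₗ[ℝ] V →ₗ[ℝ] ℝ)
    (halt : ∀ u : V, α u u = 0)
    (hanti : ∀ u v : V, α (J u) (J v) = -α u v)
    (K : Module.End ℝ V)
    (hK : ∀ u v : V, ⟪u, K v⟫ = α u v) :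
    ∃ t₀ : ℝ, 0 < t₀ ∧ ∀ t : ℝ, 0 < t → t < t₀ →
      ∀ u : V, u ≠ 0 →
        0 < ⟪J u, (Ring.inverse (1 + t • (J * K)) * J * (1 + t • (J * K))) u⟫ := by
  have hA := inner_self_comp_eq_zero hJ2 hJorth halt hanti hK
  let L : V →L[ℝ] V := LinearMap.toContinuousLinearMap (J * K)
  have hL : ∀ v, L v = J (K v) := fun v => rfl
  refine ⟨(‖L‖ + 1)⁻¹, by positivity, fun t ht ht₀ u hu => ?_⟩
  have hunit : IsUnit (1 + t • (J * K)) := isUnit_one_add_smul_of_inner_self_eq_zero hA t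
  set w := (Ring.inverse (1 + t • (J * K)) * J * (1 + t • (J * K))) u with hw
  have hPw : (1 + t • (J * K)) w = J ((1 + t • (J * K)) u) := by
    rw [hw, ← Module.End.mul_apply, ← mul_assoc, ← mul_assoc, Ring.mul_inverse_cancel _ hunit,
      one_mul, Module.End.mul_apply]
  have hsub : w - J u = -(t • L (w + J u)) := by
    have hJK := anticommute_of_antiInvariant hJ2 hJorth hanti hK u
    simp only [LinearMap.add_apply, Module.End.one_apply, LinearMap.smul_apply,
      Module.End.mul_apply, map_add, map_smul] at hPw
    rw [hL, map_add, map_add, hJK, map_neg, smul_add, smul_neg]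
    linear_combination (norm := module) hPw
  have hJu : J u ≠ 0 := fun h => hu (by simpa [h] using hJ2 u)
  have hs : w + J u ≠ 0 := fun h => by
    rw [h, map_zero, smul_zero, neg_zero, sub_eq_zero] at hsub
    rw [hsub, ← two_smul ℝ] at h
    exact hJu ((smul_eq_zero.mp h).resolve_left two_ne_zero)
  have htL : t * ‖L‖ < 1 := by
    have h := (lt_inv_comm₀ ht (by positivity)).mp ht₀
    have h' := mul_lt_mul_of_pos_left h ht
    rw [mul_inv_cancel₀ ht.ne'] at h'
    linarith
  refine inner_pos_of_norm_sub_lt_norm_add ?_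
  calc ‖w - J u‖ = t * ‖L (w + J u)‖ := by
        rw [hsub, norm_neg, norm_smul, Real.norm_of_nonneg ht.le]
    _ ≤ t * (‖L‖ * ‖w + J u‖) := by gcongr; exact L.le_opNorm _
    _ = t * ‖L‖ * ‖w + J u‖ := by ring
    _ < ‖w + J u‖ := mul_lt_of_lt_one_left (norm_pos_iff.mpr hs) htL
end

section
/- Let E be a finite-dimensional real normed vector space, U ⊆ E an open set, and let α : U → (alternating bilinear forms on E) be a differentiable map which is closed in the sense that for all x ∈ U and all u, v, w ∈ E one has (Dα(x)u)(v, w) + (Dα(x)v)(w, u) + (Dα(x)w)(u, v) = 0, where Dα(x) denotes the Fréchet derivative of α at x. Let X, Y : U → E be differentiable vector fields such that α(x)(X(x), w) = 0 and α(x)(Y(x), w) = 0 for all x ∈ U and all w ∈ E. Then the Lie bracket [X, Y](x) := DY(x)(X(x)) − DX(x)(Y(x)) also satisfies α(x)([X, Y](x), w) = 0 for all x ∈ U and all w ∈ E. -/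
/-- Differentiating `α(y)(Z y, w) = 0` in the direction `u`. -/
theorem fderiv_apply_add_apply_fderiv_eq_zero_of_eventually
    {E : Type*} [NormedAddCommGroup E] [NormedSpace ℝ E]
    {α : E → (E →L[ℝ] E →L[ℝ] ℝ)} {Z : E → E} {x : E}
    (hα : DifferentiableAt ℝ α x) (hZ : DifferentiableAt ℝ Z x)
    (hker : ∀ᶠ y in nhds x, ∀ w : E, α y (Z y) w = 0) (u w : E) :
    fderiv ℝ α x u (Z x) w + α x (fderiv ℝ Z x u) w = 0 := by
  have h := hα.hasFDerivAt.clm_apply hZ.hasFDerivAt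
  have h0 : (fun y => α y (Z y)) =ᶠ[nhds x] fun _ => 0 :=
    hker.mono fun y hy => ContinuousLinearMap.ext hy
  have heq := h.unique ((hasFDerivAt_const (0 : E →L[ℝ] ℝ) x).congr_of_eventuallyEq h0)
  have h' := congrArg (fun L : E →L[ℝ] E →L[ℝ] ℝ => L u w) heq
  simp only [add_apply, ContinuousLinearMap.comp_apply, ContinuousLinearMap.flip_apply, zero_apply] at h'
  linarith

/-- The derivative of a family of alternating bilinear forms takes alternating values. -/
theorem fderiv_apply_self_eq_zero_of_eventually
    {E : Type*} [NormedAddCommGroup E] [NormedSpace ℝ E]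
    {α : E → (E →L[ℝ] E →L[ℝ] ℝ)} {x : E} (hα : DifferentiableAt ℝ α x)
    (halt : ∀ᶠ y in nhds x, ∀ v : E, α y v v = 0) (u v : E) :
    fderiv ℝ α x u v v = 0 := by
  have h := (hα.hasFDerivAt.clm_apply (hasFDerivAt_const v x)).clm_apply (hasFDerivAt_const v x)
  have h0 : (fun y => α y v v) =ᶠ[nhds x] fun _ => 0 := halt.mono fun y hy => hy v
  have heq := h.unique ((hasFDerivAt_const (0 : ℝ) x).congr_of_eventuallyEq h0)
  simpa using congrArg (fun L : E →L[ℝ] ℝ => L u) heq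

/-- If `α` is a differentiable family of alternating bilinear forms on
an open set `U` of a finite-dimensional real normed space `E`, closed in the sense
that the cyclic sum of its Fréchet derivative vanishes, and `X`, `Y` are
differentiable vector fields on `U` with `α(x)(X x, ·) = 0` and `α(x)(Y x, ·) = 0`,
then the Lie bracket `[X, Y](x) = DY(x)(X x) - DX(x)(Y x)` also satisfies
`α(x)([X, Y] x, ·) = 0` on `U`. -/
theorem lie_bracket_in_ker_of_closed
    {E : Type*} [NormedAddCommGroup E] [NormedSpace ℝ E] [FiniteDimensional ℝ E]
    (U : Set E) (hU : IsOpen U)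
    (α : E → (E →L[ℝ] E →L[ℝ] ℝ))
    (hαdiff : ∀ x ∈ U, DifferentiableAt ℝ α x)
    (hαalt : ∀ x ∈ U, ∀ u : E, α x u u = 0)
    (hclosed : ∀ x ∈ U, ∀ u v w : E,
      fderiv ℝ α x u v w + fderiv ℝ α x v w u + fderiv ℝ α x w u v = 0)
    (X Y : E → E)
    (hX : ∀ x ∈ U, DifferentiableAt ℝ X x)
    (hY : ∀ x ∈ U, DifferentiableAt ℝ Y x)
    (hXker : ∀ x ∈ U, ∀ w : E, α x (X x) w = 0)
    (hYker : ∀ x ∈ U, ∀ w : E, α x (Y x) w = 0) :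
    ∀ x ∈ U, ∀ w : E, α x (fderiv ℝ Y x (X x) - fderiv ℝ X x (Y x)) w = 0 := by
  intro x hx w
  have halt : ∀ u v : E, α x u v = -α x v u := by
    intro u v
    have h := hαalt x hx (u + v)
    simp only [map_add, add_apply, hαalt x hx] at h
    linarith
  have hsymm := fderiv_apply_self_eq_zero_of_eventually (hαdiff x hx)
    (Filter.eventually_of_mem (hU.mem_nhds hx) hαalt)
  have hX' := fderiv_apply_add_apply_fderiv_eq_zero_of_eventually (hαdiff x hx) (hX x hx)
    (Filter.eventually_of_mem (hU.mem_nhds hx) hXker)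
  have hY' := fderiv_apply_add_apply_fderiv_eq_zero_of_eventually (hαdiff x hx) (hY x hx)
    (Filter.eventually_of_mem (hU.mem_nhds hx) hYker)
  have hswap : fderiv ℝ α x (Y x) w (X x) = -fderiv ℝ α x (Y x) (X x) w := by
    have h := hsymm (Y x) (w + X x)
    simp only [map_add, add_apply, hsymm] at h
    linarith
  have hXY : α x (fderiv ℝ X x w) (Y x) = 0 := by
    rw [halt, hYker x hx, neg_zero]
  rw [map_sub, sub_apply]
  linarith [hclosed x hx (X x) (Y x) w, hX' (Y x) w, hY' (X x) w, hX' w (Y x)]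
end
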